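/- Linear change of variables in the Berezin integral: Let A = (A_{jk}) be an n×n matrix with entries in 𝔠_ev that is invertible as a matrix over the commutative ring 𝔠_ev. Then for every v ∈ 𝒫_n: ∫dθ v(θ) = (det A)^{-1} ∫dθ v(Aθ), where v(Aθ) denotes the substitution θ_j ↦ Σ_{k=1}^n A_{jk} θ_k. -/

import Mathlib

set_option synthInstance.maxHeartbeats 1000000
set_option maxHeartbeats 2000000

noncomputable section

/-- The underlying module: countably many generators for `𝔠` plus `n` odd generators `θ`. -/
abbrev GV (n : ℕ) : Type := (ℕ →₀ ℂ) × (Fin n → ℂ)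

/-- The big Grassmann algebra `E`, an exterior algebra; `𝒫_n = E`. -/
abbrev GE (n : ℕ) : Type := ExteriorAlgebra ℂ (GV n)

variable (n : ℕ)

/-- The odd generators `θ₁,…,θₙ`. -/
def θg (k : Fin n) : GE n := ExteriorAlgebra.ι ℂ ((0 : ℕ →₀ ℂ), Pi.single k 1)

/-- The subalgebra `𝔠` generated by the countably many generators. -/
def cAlg : Subalgebra ℂ (GE n) :=
  Algebra.adjoin ℂ (Set.range fun v : ℕ →₀ ℂ => ExteriorAlgebra.ι ℂ (v, (0 : Fin n → ℂ)))

/-- The even part of `E`. -/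
def evenPart : Submodule ℂ (GE n) := CliffordAlgebra.evenOdd (0 : QuadraticForm ℂ (GV n)) 0

/-- The odd part of `E`. -/
def oddPart : Submodule ℂ (GE n) := CliffordAlgebra.evenOdd (0 : QuadraticForm ℂ (GV n)) 1

/-- Left odd derivative `∂_{θ_s}`: contraction with the dual functional of `θ_s`. -/
def Dθ (s : Fin n) : GE n →ₗ[ℂ] GE n :=
  CliffordAlgebra.contractLeft ((LinearMap.proj s).comp (LinearMap.snd ℂ (ℕ →₀ ℂ) (Fin n → ℂ)))

/-- The algebra endomorphism setting all `θ`'s to zero. -/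
def evalθ0 : GE n →ₐ[ℂ] GE n :=
  CliffordAlgebra.map ⟨(LinearMap.fst ℂ (ℕ →₀ ℂ) (Fin n → ℂ)).prod 0, fun _ => rfl⟩

/-- The Berezin integral `∫ dθ v = ∂_{θ_n} ⋯ ∂_{θ_1} v |_{θ=0} = v_{1̄}`. -/
def berezin (v : GE n) : GE n :=
  evalθ0 n ((List.finRange n).foldl (fun w s => Dθ n s w) v)

/-- `θ^a` for a multi-index `a ∈ {0,1}ⁿ`, factors in increasing order. -/
def θpow (a : Fin n → Bool) : GE n :=
  (List.ofFn fun k => if a k then θg n k else 1).prod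

/-- `|a|`: the number of `1` entries of the multi-index `a`. -/
def mIdxCard (a : Fin n → Bool) : ℕ := (Finset.univ.filter fun k => a k).card


/-- Determinant of a matrix with entries in `E` (entries are assumed central, e.g. even
elements of `𝔠`), as the usual signed sum over permutations of ordered products. -/
def detE (M : Matrix (Fin n) (Fin n) (GE n)) : GE n :=
  ∑ σ : Equiv.Perm (Fin n), (Equiv.Perm.sign σ : ℤ) • (List.ofFn fun i => M (σ i) i).prod

/-- Products of `n` linear combinations of pairwise anticommuting square-zero elements
`θ₁,…,θₙ` are determinantal multiples of `θ₁⋯θₙ`. -/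
theorem List.prod_ofFn_sum_smul_eq_det_smul {R E : Type*} [CommRing R] [Ring E] [Algebra R E]
    {n : ℕ} (θ : Fin n → E) (hsq : ∀ i, θ i * θ i = 0)
    (hanti : ∀ i j, θ i * θ j + θ j * θ i = 0) (A : Matrix (Fin n) (Fin n) R) :
    (List.ofFn fun i => ∑ k, A i k • θ k).prod = A.det • (List.ofFn θ).prod := by
  let Φ : (Fin n → R) →ₗ[R] E := Fintype.linearCombination R θ
  have hΦ : ∀ v, Φ v * Φ v = 0 := by
    intro v
    simp only [Φ, Fintype.linearCombination_apply, Finset.sum_mul_sum]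
    rw [← Finset.sum_product']
    refine Finset.sum_involution (fun p _ => p.swap) ?_ ?_ ?_ ?_
    · rintro ⟨i, j⟩ -
      simp only [Prod.swap, smul_mul_smul_comm]
      rw [mul_comm (v j), ← smul_add, hanti, smul_zero]
    · rintro ⟨i, j⟩ - h h'
      simp only [Prod.swap, Prod.mk.injEq] at h'
      obtain ⟨rfl, -⟩ := h'
      simp [hsq] at h
    · simp
    · simp
  let L := ExteriorAlgebra.lift R ⟨Φ, hΦ⟩
  let f : (Fin n → R) [⋀^Fin n]→ₗ[R] E :=
    L.toLinearMap.compAlternatingMap (ExteriorAlgebra.ιMulti R n)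
  have hf : ∀ v, f v = (List.ofFn fun i => Φ (v i)).prod := by
    intro v
    simp only [f, LinearMap.compAlternatingMap_apply, ExteriorAlgebra.ιMulti_apply,
      AlgHom.toLinearMap_apply, map_list_prod, List.map_ofFn]
    congr 2
    funext i
    simp [L]
  have key : f = (LinearMap.toSpanSingleton R E (List.ofFn θ).prod).compAlternatingMap
      Matrix.detRowAlternating := by
    refine (Pi.basisFun R (Fin n)).ext_alternating fun v hv => ?_
    let σ : Equiv.Perm (Fin n) := Equiv.ofBijective v (Finite.injective_iff_bijective.mp hv)
    change f ((Pi.basisFun R (Fin n)) ∘ σ) =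
      LinearMap.compAlternatingMap _ _ ((Pi.basisFun R (Fin n)) ∘ σ)
    rw [AlternatingMap.map_perm, AlternatingMap.map_perm, hf]
    have hone : Matrix.detRowAlternating (R := R) (Pi.basisFun R (Fin n)) = 1 := by
      rw [← Matrix.det_one (n := Fin n) (R := R)]
      refine congrArg Matrix.detRowAlternating ?_
      ext i j
      simp [Matrix.one_apply, Pi.single_apply, eq_comm]
    simp [hone, Φ, Fintype.linearCombination_apply, Pi.single_apply]
  have h := hf A
  rw [key] at h
  simp only [Φ, Fintype.linearCombination_apply] at h
  exact h.symm

section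

variable {n}

theorem θg_mul_self (i : Fin n) : θg n i * θg n i = 0 := ExteriorAlgebra.ι_sq_zero _

theorem θg_mul_add_swap (i j : Fin n) : θg n i * θg n j + θg n j * θg n i = 0 :=
  ExteriorAlgebra.ι_add_mul_swap _ _

theorem mem_center_of_mem_evenPart {x : GE n} (hx : x ∈ evenPart n) :
    x ∈ Subalgebra.center ℂ (GE n) := by
  have h1 : ∀ w : GV n, ExteriorAlgebra.ι ℂ w * x = x * ExteriorAlgebra.ι ℂ w := by
    intro w
    have sw : ∀ a : GV n, ExteriorAlgebra.ι ℂ w * ExteriorAlgebra.ι ℂ a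
        = - (ExteriorAlgebra.ι ℂ a * ExteriorAlgebra.ι ℂ w) :=
      fun a => eq_neg_of_add_eq_zero_left (ExteriorAlgebra.ι_add_mul_swap _ _)
    refine CliffordAlgebra.even_induction (Q := (0 : QuadraticForm ℂ (GV n)))
      (motive := fun x _ => ExteriorAlgebra.ι ℂ w * x = x * ExteriorAlgebra.ι ℂ w)
      ?_ ?_ ?_ x hx
    · intro r; exact (Algebra.commutes r _).symm
    · intro x y _ _ h1 h2; rw [mul_add, add_mul, h1, h2]
    · intro a b x _ h
      change ExteriorAlgebra.ι ℂ w * (ExteriorAlgebra.ι ℂ a * ExteriorAlgebra.ι ℂ b * x)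
        = ExteriorAlgebra.ι ℂ a * ExteriorAlgebra.ι ℂ b * x * ExteriorAlgebra.ι ℂ w
      simp only [mul_assoc]
      rw [← h, ← mul_assoc, sw a, neg_mul, mul_assoc, ← mul_assoc _ _ x, sw b]
      simp [mul_assoc]
  rw [Subalgebra.mem_center_iff]
  intro b
  induction b using ExteriorAlgebra.induction with
  | algebraMap r => exact Algebra.commutes r _
  | ι w => exact h1 w
  | mul a b ha hb => rw [mul_assoc, hb, ← mul_assoc, ha, mul_assoc]
  | add a b ha hb => rw [add_mul, mul_add, ha, hb]

theorem Dθ_mul_of_eq_zero (s : Fin n) {c : GE n} (hc : Dθ n s c = 0) (w : GE n) :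
    Dθ n s (w * c) = Dθ n s w * c := by
  induction w using CliffordAlgebra.left_induction with
  | algebraMap r =>
    rw [← Algebra.smul_def, map_smul, hc]
    simp [Dθ, CliffordAlgebra.contractLeft_algebraMap]
  | add x y hx hy => rw [add_mul, map_add, map_add, add_mul, hx, hy]
  | ι_mul x m hx =>
    rw [mul_assoc]
    simp only [Dθ] at hx ⊢
    rw [CliffordAlgebra.contractLeft_ι_mul, CliffordAlgebra.contractLeft_ι_mul, hx, sub_mul,
      smul_mul_assoc, mul_assoc]

theorem Dθ_eq_zero_of_mem_cAlg (s : Fin n) {c : GE n} (hc : c ∈ cAlg n) : Dθ n s c = 0 := by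
  induction hc using Algebra.adjoin_induction with
  | mem x hx =>
    obtain ⟨v, rfl⟩ := hx
    exact (CliffordAlgebra.contractLeft_ι _ _ _).trans (by simp)
  | algebraMap r => exact CliffordAlgebra.contractLeft_algebraMap _ _ r
  | add x y _ _ hx hy => rw [map_add, hx, hy, add_zero]
  | mul x y _ _ hx hy => rw [Dθ_mul_of_eq_zero s hy, hx, zero_mul]

theorem Dθ_mul_of_mem_cAlg (s : Fin n) {c : GE n} (hc : c ∈ cAlg n) (w : GE n) :
    Dθ n s (w * c) = Dθ n s w * c :=
  Dθ_mul_of_eq_zero s (Dθ_eq_zero_of_mem_cAlg s hc) w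

/-- An algebra endomorphism fixing the generators of `𝔠` fixes `𝔠`. -/
theorem map_eq_self_of_mem_cAlg (S : GE n →ₐ[ℂ] GE n)
    (hS : ∀ x : ℕ →₀ ℂ, S (ExteriorAlgebra.ι ℂ (x, (0 : Fin n → ℂ)))
      = ExteriorAlgebra.ι ℂ (x, (0 : Fin n → ℂ))) {c : GE n} (hc : c ∈ cAlg n) : S c = c := by
  induction hc using Algebra.adjoin_induction with
  | mem x hx => obtain ⟨v, rfl⟩ := hx; exact hS v
  | algebraMap r => exact S.commutes r
  | add x y _ _ hx hy => rw [map_add, hx, hy]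
  | mul x y _ _ hx hy => rw [map_mul, hx, hy]

theorem evalθ0_of_mem_cAlg {c : GE n} (hc : c ∈ cAlg n) : evalθ0 n c = c :=
  map_eq_self_of_mem_cAlg (evalθ0 n)
    (fun _ => (CliffordAlgebra.map_apply_ι _ _).trans rfl) hc

theorem berezin_mul_of_mem_cAlg {c : GE n} (hc : c ∈ cAlg n) (w : GE n) :
    berezin n (w * c) = berezin n w * c := by
  have h : ∀ (l : List (Fin n)) (w : GE n),
      l.foldl (fun w s => Dθ n s w) (w * c) = l.foldl (fun w s => Dθ n s w) w * c := by
    intro l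
    induction l with
    | nil => simp
    | cons s l ih => intro w; simp [Dθ_mul_of_mem_cAlg s hc, ih]
  rw [berezin, h, map_mul, evalθ0_of_mem_cAlg hc, berezin]

theorem berezin_add (v w : GE n) : berezin n (v + w) = berezin n v + berezin n w := by
  have h : ∀ (l : List (Fin n)) (v w : GE n),
      l.foldl (fun w s => Dθ n s w) (v + w)
        = l.foldl (fun w s => Dθ n s w) v + l.foldl (fun w s => Dθ n s w) w := by
    intro l
    induction l with
    | nil => simp
    | cons s l ih => intro v w; simp [ih]
  rw [berezin, h, map_add, berezin, berezin]

theorem berezin_zero : berezin n (0 : GE n) = 0 := by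
  simpa using berezin_mul_of_mem_cAlg (zero_mem (cAlg n)) (0 : GE n)

variable (n) in
/-- The elements annihilated by any `m` of the derivatives `∂_{θ_s}`. -/
def KilledBy : ℕ → GE n → Prop
  | 0, w => w = 0
  | m + 1, w => ∀ s, KilledBy m (Dθ n s w)

theorem KilledBy.succ {m : ℕ} {w : GE n} (h : KilledBy n m w) : KilledBy n (m + 1) w := by
  induction m generalizing w with
  | zero => intro s; rw [show w = 0 from h, map_zero]; rfl
  | succ m ih => exact fun s => ih (h s)

theorem KilledBy.mono {m k : ℕ} (hmk : m ≤ k) {w : GE n} (h : KilledBy n m w) :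
    KilledBy n k w := by
  induction hmk with
  | refl => exact h
  | step _ ih => exact ih.succ

theorem KilledBy.zero (m : ℕ) : KilledBy n m 0 :=
  KilledBy.mono (Nat.zero_le m) (show KilledBy n 0 0 from rfl)

theorem KilledBy.add {m : ℕ} {v w : GE n} (hv : KilledBy n m v) (hw : KilledBy n m w) :
    KilledBy n m (v + w) := by
  induction m generalizing v w with
  | zero => rw [show v = 0 from hv, show w = 0 from hw, add_zero]; rfl
  | succ m ih => intro s; rw [map_add]; exact ih (hv s) (hw s)

theorem KilledBy.neg {m : ℕ} {w : GE n} (hw : KilledBy n m w) : KilledBy n m (-w) := by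
  induction m generalizing w with
  | zero => rw [show w = 0 from hw, neg_zero]; rfl
  | succ m ih => intro s; rw [map_neg]; exact ih (hw s)

theorem KilledBy.mul_right {m : ℕ} {w c : GE n} (hc : c ∈ cAlg n) (hw : KilledBy n m w) :
    KilledBy n m (w * c) := by
  induction m generalizing w with
  | zero => rw [show w = 0 from hw, zero_mul]; rfl
  | succ m ih => intro s; rw [Dθ_mul_of_mem_cAlg s hc]; exact ih (hw s)

theorem KilledBy.sum {m : ℕ} {ι : Type*} (t : Finset ι) {f : ι → GE n}
    (hf : ∀ i ∈ t, KilledBy n m (f i)) : KilledBy n m (∑ i ∈ t, f i) :=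
  Finset.sum_induction f (KilledBy n m) (fun _ _ => KilledBy.add) (KilledBy.zero m) hf

theorem KilledBy.θg_mul {m : ℕ} {w : GE n} (hw : KilledBy n m w) (k : Fin n) :
    KilledBy n (m + 1) (θg n k * w) := by
  induction m generalizing w with
  | zero => rw [show w = 0 from hw, mul_zero]; exact KilledBy.zero _
  | succ m ih =>
    intro s
    rw [Dθ, θg]
    erw [CliffordAlgebra.contractLeft_ι_mul]
    rw [sub_eq_add_neg, Algebra.smul_def, Algebra.commutes]
    exact (hw.mul_right (algebraMap_mem _ _)).add (ih (hw s)).neg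

theorem KilledBy.berezin_eq_zero {w : GE n} (hw : KilledBy n n w) : berezin n w = 0 := by
  have h : ∀ (l : List (Fin n)) (w : GE n), KilledBy n l.length w →
      l.foldl (fun w s => Dθ n s w) w = 0 := by
    intro l
    induction l with
    | nil => exact fun _ h => h
    | cons s l ih => exact fun w h => ih _ (h s)
  rw [berezin, h _ _ (by simpa using hw), map_zero]

theorem killedBy_list_prod {c : GE n} (hc : c ∈ cAlg n) (l : List (GE n))
    (hl : ∀ φ ∈ l, ∃ a : Fin n → GE n,
      (∀ k, a k ∈ cAlg n ∧ a k ∈ Subalgebra.center ℂ (GE n)) ∧ φ = ∑ k, a k * θg n k) :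
    KilledBy n (l.length + 1) (l.prod * c) := by
  induction l with
  | nil =>
    intro s
    simp [Dθ_eq_zero_of_mem_cAlg s hc, KilledBy]
  | cons φ l ih =>
    obtain ⟨a, ha, rfl⟩ := hl φ (by simp)
    rw [List.prod_cons, mul_assoc, Finset.sum_mul]
    refine KilledBy.sum _ fun k _ => ?_
    rw [mul_assoc, ← Subalgebra.mem_center_iff.mp (ha k).2]
    exact ((ih fun ψ hψ => hl ψ (by simp [hψ])).θg_mul k).mul_right (ha k).1

/-- Every element is a sum of terms `θ_{l₁}⋯θ_{l_m} c` with `c ∈ 𝔠`. -/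
theorem GE_induction {P : GE n → Prop} (hadd : ∀ v w, P v → P w → P (v + w))
    (hprod : ∀ (l : List (Fin n)) (c : GE n), c ∈ cAlg n → P ((l.map (θg n)).prod * c))
    (v : GE n) : P v := by
  let M : AddSubmonoid (GE n) := AddSubmonoid.closure
    {x | ∃ (l : List (Fin n)) (c : GE n), c ∈ cAlg n ∧ x = (l.map (θg n)).prod * c}
  have hM : ∀ x, x ∈ M := by
    intro x
    induction x using CliffordAlgebra.left_induction with
    | algebraMap r =>
      exact AddSubmonoid.subset_closure ⟨[], _, algebraMap_mem _ r, by simp⟩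
    | add x y hx hy => exact add_mem hx hy
    | ι_mul x m hx =>
      have hm : ExteriorAlgebra.ι ℂ m = ExteriorAlgebra.ι ℂ (m.1, (0 : Fin n → ℂ))
          + ∑ k, m.2 k • θg n k := by
        simp only [θg, ← map_smul, ← map_sum, ← map_add]
        congr 1
        ext i
        · simp [Prod.fst_sum]
        · simp [Prod.snd_sum, Finset.sum_apply, Pi.single_apply]
      have h0 : ∀ (l : List (Fin n)) (x : ℕ →₀ ℂ), ∃ r : ℂ,
          ExteriorAlgebra.ι ℂ (x, (0 : Fin n → ℂ)) * (l.map (θg n)).prod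
            = (l.map (θg n)).prod * r • ExteriorAlgebra.ι ℂ (x, (0 : Fin n → ℂ)) := by
        intro l x
        induction l with
        | nil => exact ⟨1, by simp⟩
        | cons k l ih =>
          obtain ⟨r, hr⟩ := ih
          refine ⟨-r, ?_⟩
          have sw : ExteriorAlgebra.ι ℂ (x, (0 : Fin n → ℂ)) * θg n k
              = -(θg n k * ExteriorAlgebra.ι ℂ (x, (0 : Fin n → ℂ))) :=
            eq_neg_of_add_eq_zero_left (ExteriorAlgebra.ι_add_mul_swap _ _)
          rw [List.map_cons, List.prod_cons, ← mul_assoc, sw, neg_mul, mul_assoc, hr,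
            neg_smul, mul_neg, mul_assoc]
      change ExteriorAlgebra.ι ℂ m * x ∈ M
      induction hx using AddSubmonoid.closure_induction with
      | zero => rw [mul_zero]; exact zero_mem M
      | add a b _ _ ha hb => rw [mul_add]; exact add_mem ha hb
      | mem y hy =>
        obtain ⟨l, c, hc, rfl⟩ := hy
        rw [hm, add_mul, Finset.sum_mul]
        refine add_mem ?_ (sum_mem fun k _ => ?_)
        · obtain ⟨r, hr⟩ := h0 l m.1
          rw [← mul_assoc, hr, mul_assoc]
          exact AddSubmonoid.subset_closure ⟨l, _, mul_mem (Subalgebra.smul_mem _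
            (Algebra.subset_adjoin (Set.mem_range_self m.1)) _) hc, rfl⟩
        · refine AddSubmonoid.subset_closure ⟨k :: l, m.2 k • c, Subalgebra.smul_mem _ hc _, ?_⟩
          rw [List.map_cons, List.prod_cons, smul_mul_assoc, mul_smul_comm, mul_assoc]
  have hv := hM v
  induction hv using AddSubmonoid.closure_induction with
  | zero => simpa using hprod [] 0 (zero_mem _)
  | add a b _ _ ha hb => exact hadd a b ha hb
  | mem y hy => obtain ⟨l, c, hc, rfl⟩ := hy; exact hprod l c hc

theorem detE_mem_cAlg {A : Matrix (Fin n) (Fin n) (GE n)} (hA : ∀ j k, A j k ∈ cAlg n) :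
    detE n A ∈ cAlg n := by
  refine sum_mem fun σ _ => zsmul_mem (list_prod_mem fun x hx => ?_) _
  obtain ⟨i, rfl⟩ := (List.mem_ofFn).mp hx
  exact hA _ _

theorem prod_ofFn_sum_mul_θg {A : Matrix (Fin n) (Fin n) (GE n)}
    (hA : ∀ j k, A j k ∈ Subalgebra.center ℂ (GE n)) :
    detE n A ∈ Subalgebra.center ℂ (GE n) ∧
      (List.ofFn fun i => ∑ k, A i k * θg n k).prod = detE n A * (List.ofFn (θg n)).prod := by
  let R := Subalgebra.center ℂ (GE n)
  let algInst : Algebra R (GE n) :=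
    R.val.toRingHom.toAlgebra' fun c x => (Subalgebra.mem_center_iff.mp c.2 x).symm
  let A' : Matrix (Fin n) (Fin n) R := fun i j => ⟨A i j, hA i j⟩
  have hdet : ((A'.det : R) : GE n) = detE n A := by
    rw [Matrix.det_apply, detE]
    change R.val _ = _
    rw [map_sum]
    refine Finset.sum_congr rfl fun σ _ => ?_
    rw [Units.smul_def]
    refine (map_zsmul R.val _ _).trans (congrArg _ ?_)
    rw [← List.prod_ofFn, map_list_prod, List.map_ofFn]
    rfl
  refine ⟨hdet ▸ A'.det.2, ?_⟩
  have h := List.prod_ofFn_sum_smul_eq_det_smul (θg n) θg_mul_self θg_mul_add_swap A'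
  rw [← hdet]
  exact h

/-- A product of `n` of the `θ`'s is scaled by `det A` under `θ ↦ Aθ`. -/
theorem map_prod_ofFn_θg_comp {A : Matrix (Fin n) (Fin n) (GE n)}
    (hA : ∀ j k, A j k ∈ Subalgebra.center ℂ (GE n)) (S : GE n →ₐ[ℂ] GE n)
    (hS : ∀ j, S (θg n j) = ∑ k, A j k * θg n k) (σ : Equiv.Perm (Fin n)) :
    S (List.ofFn (θg n ∘ σ)).prod = detE n A * (List.ofFn (θg n ∘ σ)).prod := by
  have h : (List.ofFn (θg n ∘ σ)).prod
      = Equiv.Perm.sign σ • (List.ofFn (θg n)).prod := by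
    have := (ExteriorAlgebra.ιMulti ℂ (M := GV n) n).map_perm
      (fun k => ((0 : ℕ →₀ ℂ), (Pi.single k 1 : Fin n → ℂ))) σ
    simp only [ExteriorAlgebra.ιMulti_apply] at this
    exact this
  rw [h, Units.smul_def, map_zsmul, mul_smul_comm, map_list_prod, List.map_ofFn,
    ← (prod_ofFn_sum_mul_θg hA).2]
  congr 3
  funext i
  exact hS i

theorem prod_map_θg_eq_zero {l : List (Fin n)} (hl : ¬ l.Nodup) :
    (l.map (θg n)).prod = 0 := by
  have h := (ExteriorAlgebra.ιMulti ℂ (M := GV n) l.length).map_eq_zero_of_not_injective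
    (fun i => ((0 : ℕ →₀ ℂ), (Pi.single (l.get i) 1 : Fin n → ℂ)))
    fun hinj => hl (List.nodup_iff_injective_get.mpr
      fun i j hij => hinj (by simp only [hij]))
  rw [ExteriorAlgebra.ιMulti_apply] at h
  rw [← h]
  congr 1
  conv_lhs => rw [← List.ofFn_get l, List.map_ofFn]
  rfl

theorem berezin_map_eq_detE_mul {A : Matrix (Fin n) (Fin n) (GE n)}
    (hA : ∀ j k, A j k ∈ cAlg n ∧ A j k ∈ evenPart n) (S : GE n →ₐ[ℂ] GE n)
    (hSfix : ∀ x : ℕ →₀ ℂ, S (ExteriorAlgebra.ι ℂ (x, (0 : Fin n → ℂ)))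
      = ExteriorAlgebra.ι ℂ (x, (0 : Fin n → ℂ)))
    (hSθ : ∀ j, S (θg n j) = ∑ k, A j k * θg n k) (v : GE n) :
    berezin n (S v) = detE n A * berezin n v := by
  have hcen : ∀ j k, A j k ∈ Subalgebra.center ℂ (GE n) :=
    fun j k => mem_center_of_mem_evenPart (hA j k).2
  have hdet : ∀ x, x * detE n A = detE n A * x :=
    Subalgebra.mem_center_iff.mp (prod_ofFn_sum_mul_θg hcen).1
  induction v using GE_induction with
  | hadd v w hv hw => rw [map_add, berezin_add, berezin_add, mul_add, hv, hw]
  | hprod l c hc =>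
    by_cases hl : l.Nodup
    · rw [map_mul, map_eq_self_of_mem_cAlg S hSfix hc]
      have hlen : l.length ≤ n := by simpa using hl.length_le_card
      rcases hlen.lt_or_eq with hlt | heq
      · have h1 : berezin n ((l.map (θg n)).prod * c) = 0 := by
          refine ((killedBy_list_prod hc _ ?_).mono (by simpa using hlt)).berezin_eq_zero
          intro φ hφ
          obtain ⟨j, -, rfl⟩ := List.mem_map.mp hφ
          refine ⟨Pi.single j 1, fun k => ?_, by simp [Pi.single_apply]⟩
          rcases eq_or_ne k j with rfl | hk
          · simp [one_mem]
          · simp [hk, zero_mem]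
        have h2 : berezin n (S (l.map (θg n)).prod * c) = 0 := by
          rw [map_list_prod, List.map_map]
          refine ((killedBy_list_prod hc _ ?_).mono (by simpa using hlt)).berezin_eq_zero
          intro φ hφ
          obtain ⟨j, -, rfl⟩ := List.mem_map.mp hφ
          exact ⟨A j, fun k => ⟨(hA j k).1, hcen j k⟩, hSθ j⟩
        rw [h1, h2, mul_zero]
      · have hinj : Function.Injective fun i : Fin n => l.get (i.cast heq.symm) :=
          (List.nodup_iff_injective_get.mp hl).comp (Fin.cast_injective _)
        let σ : Equiv.Perm (Fin n) :=
          Equiv.ofBijective _ (Finite.injective_iff_bijective.mp hinj)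
        have hlσ : l.map (θg n) = List.ofFn (θg n ∘ σ) :=
          List.ext_get (by simp [heq]) fun i h1 h2 => by simp [σ]
        rw [hlσ, map_prod_ofFn_θg_comp hcen S hSθ σ, mul_assoc, ← hdet,
          berezin_mul_of_mem_cAlg (detE_mem_cAlg fun j k => (hA j k).1), hdet]
    · rw [prod_map_θg_eq_zero hl, zero_mul, map_zero, berezin_zero, mul_zero]

end

/-- **Linear change of variables in the Berezin integral.**
Let `A = (A_{jk})` be an `n×n` matrix with entries in `𝔠_ev`, invertible as a matrix over the
commutative ring `𝔠_ev` (witnessed by a two-sided inverse with entries in `𝔠_ev`).  Then for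
every `v ∈ 𝒫_n`, `∫dθ v(θ) = (det A)⁻¹ ∫dθ v(Aθ)`, where `v(Aθ)` is realized by any algebra
endomorphism `S` fixing the generators of `𝔠` with `S(θ_j) = Σ_k A_{jk} θ_k`, and `(det A)⁻¹`
is the (two-sided) inverse `d` of `det A`. -/
theorem berezin_linear_change_of_variables
    (A : Matrix (Fin n) (Fin n) (GE n))
    (hA : ∀ j k, A j k ∈ cAlg n ∧ A j k ∈ evenPart n)
    (hAinv : ∃ B : Matrix (Fin n) (Fin n) (GE n),
      (∀ j k, B j k ∈ cAlg n ∧ B j k ∈ evenPart n) ∧ A * B = 1 ∧ B * A = 1)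
    (d : GE n) (hd₁ : detE n A * d = 1) (hd₂ : d * detE n A = 1)
    (S : GE n →ₐ[ℂ] GE n)
    (hSfix : ∀ x : ℕ →₀ ℂ, S (ExteriorAlgebra.ι ℂ (x, (0 : Fin n → ℂ)))
      = ExteriorAlgebra.ι ℂ (x, (0 : Fin n → ℂ)))
    (hSθ : ∀ j, S (θg n j) = ∑ k, A j k * θg n k)
    (v : GE n) :
    berezin n v = d * berezin n (S v) := by
  rw [berezin_map_eq_detE_mul hA S hSfix hSθ, ← mul_assoc, hd₂, one_mul]
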